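/- arXiv:1709.06230 — 2 statements merged into one kernel-verified Lean document; each statement's English description precedes it below -/
import Mathlib

section
/- The double integral over ℝ² of Φ(min(x,y))²·(1 − Φ(max(x,y)))² / (φ(x)·φ(y)) with respect to dx dy is finite. (Up to the factor 2 this integrand equals the covariance Cov(b²(x), b²(y)) of the squared φ-Brownian bridge, so the statement is the finiteness of ∫∫ Cov(b²(x),b²(y))/(φ(x)φ(y)) dx dy.) -/
open Real MeasureTheory Filter

/-- The standard normal density. -/
noncomputable def stdNormalPDF (x : ℝ) : ℝ := (Real.sqrt (2 * Real.pi))⁻¹ * Real.exp (-x ^ 2 / 2)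

/-- The standard normal distribution function. -/
noncomputable def stdNormalCDF (x : ℝ) : ℝ := ∫ t in Set.Iic x, stdNormalPDF t

lemma stdNormalPDF_eq_gaussianPDFReal : stdNormalPDF = ProbabilityTheory.gaussianPDFReal 0 1 := by
  ext x
  simp [stdNormalPDF, ProbabilityTheory.gaussianPDFReal]

lemma stdNormalPDF_pos (x : ℝ) : 0 < stdNormalPDF x := by
  unfold stdNormalPDF
  positivity

lemma stdNormalPDF_neg (x : ℝ) : stdNormalPDF (-x) = stdNormalPDF x := by
  simp [stdNormalPDF]

lemma integrable_stdNormalPDF : Integrable stdNormalPDF := by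
  rw [stdNormalPDF_eq_gaussianPDFReal]
  exact ProbabilityTheory.integrable_gaussianPDFReal 0 1

lemma integral_stdNormalPDF : ∫ x, stdNormalPDF x = 1 := by
  rw [stdNormalPDF_eq_gaussianPDFReal]
  exact ProbabilityTheory.integral_gaussianPDFReal_eq_one 0 one_ne_zero

lemma one_sub_stdNormalCDF (x : ℝ) :
    1 - stdNormalCDF x = ∫ t in Set.Ioi x, stdNormalPDF t := by
  have h := integral_add_compl (measurableSet_Iic (a := x)) integrable_stdNormalPDF
  rw [integral_stdNormalPDF, Set.compl_Iic] at h
  rw [stdNormalCDF]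
  linarith

lemma stdNormalCDF_neg (x : ℝ) : stdNormalCDF (-x) = 1 - stdNormalCDF x := by
  rw [one_sub_stdNormalCDF, stdNormalCDF, ← integral_comp_neg_Ioi]
  simp [stdNormalPDF_neg]

lemma stdNormalCDF_nonneg (x : ℝ) : 0 ≤ stdNormalCDF x :=
  integral_nonneg fun t => (stdNormalPDF_pos t).le

lemma stdNormalCDF_le_one (x : ℝ) : stdNormalCDF x ≤ 1 := by
  have h := stdNormalCDF_nonneg (-x)
  rw [stdNormalCDF_neg] at h
  linarith

/-- A form of the Mills ratio bound that stays finite at the origin. -/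
lemma one_sub_stdNormalCDF_le {y : ℝ} (hy : 0 ≤ y) :
    1 - stdNormalCDF y ≤ exp (1 / 2) * stdNormalPDF y / (1 + y) := by
  rw [one_sub_stdNormalCDF]
  have hneg : -(1 + y) < 0 := by linarith
  have hpt (t : ℝ) : stdNormalPDF t ≤
      exp (1 / 2) * stdNormalPDF y * exp ((1 + y) * y) * exp (-(1 + y) * t) := by
    have : exp (-t ^ 2 / 2) ≤ exp (1 / 2 + -y ^ 2 / 2 + (1 + y) * y + -(1 + y) * t) := by
      apply exp_le_exp.2
      nlinarith [sq_nonneg (t - y - 1)]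
    rw [exp_add, exp_add, exp_add] at this
    unfold stdNormalPDF
    calc _ ≤ (√(2 * π))⁻¹ *
          (exp (1 / 2) * exp (-y ^ 2 / 2) * exp ((1 + y) * y) * exp (-(1 + y) * t)) := by gcongr
      _ = _ := by ring
  calc _ ≤ ∫ t in Set.Ioi y,
        exp (1 / 2) * stdNormalPDF y * exp ((1 + y) * y) * exp (-(1 + y) * t) :=
        setIntegral_mono integrable_stdNormalPDF.integrableOn
          ((integrableOn_exp_mul_Ioi hneg y).const_mul _) hpt
    _ = _ := by
        rw [integral_const_mul, integral_exp_mul_Ioi hneg]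
        have : exp ((1 + y) * y) * exp (-(1 + y) * y) = 1 := by
          rw [← exp_add, neg_mul, add_neg_cancel, exp_zero]
        have h1 : (1 + y) ≠ 0 := by positivity
        rw [neg_div_neg_eq, mul_div_assoc', mul_assoc (_ * _), this, mul_one]

lemma exp_neg_le_of_nonneg {x y : ℝ} (hx : 0 ≤ x) (hxy : x ≤ y) :
    exp ((x ^ 2 - y ^ 2) / 2) ≤ exp (1 / 2) * exp (-|x - y| / 2) := by
  rw [← exp_add, exp_le_exp, abs_of_nonpos (by linarith)]
  rcases le_total 1 (x + y) with h | h <;> nlinarith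

lemma stdNormalPDF_div (x y : ℝ) :
    stdNormalPDF y / stdNormalPDF x = exp ((x ^ 2 - y ^ 2) / 2) := by
  unfold stdNormalPDF
  rw [mul_div_mul_left _ _ (by positivity), ← exp_sub]
  ring_nf

lemma integrand_le_of_nonneg {x y z : ℝ} (hx : 0 ≤ x) (hxy : x ≤ y) (hz : z ^ 2 ≤ y ^ 2) :
    stdNormalCDF x ^ 2 * (1 - stdNormalCDF y) ^ 2 / (stdNormalPDF x * stdNormalPDF y) ≤
      exp 3 * ((1 + z ^ 2)⁻¹ * exp (-|x - y| / 2)) := by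
  have hy := hx.trans hxy
  have hpx := stdNormalPDF_pos x
  have hpy := stdNormalPDF_pos y
  have h0 : 0 ≤ 1 - stdNormalCDF y := sub_nonneg.2 (stdNormalCDF_le_one y)
  calc _ ≤ 1 ^ 2 * (exp (1 / 2) * stdNormalPDF y / (1 + y)) ^ 2 /
          (stdNormalPDF x * stdNormalPDF y) := by
        gcongr
        · exact stdNormalCDF_nonneg x
        · exact stdNormalCDF_le_one x
        · exact one_sub_stdNormalCDF_le hy
    _ = exp (1 / 2) ^ 2 * (((1 + y) ^ 2)⁻¹ * (stdNormalPDF y / stdNormalPDF x)) := by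
        field_simp
    _ ≤ exp (1 / 2) ^ 2 * ((1 + z ^ 2)⁻¹ * (exp (1 / 2) * exp (-|x - y| / 2))) := by
        rw [stdNormalPDF_div]
        gcongr
        · nlinarith
        · exact exp_neg_le_of_nonneg hx hxy
    _ = exp (3 / 2) * ((1 + z ^ 2)⁻¹ * exp (-|x - y| / 2)) := by
        rw [show (3 / 2 : ℝ) = 1 / 2 + 1 / 2 + 1 / 2 by norm_num, exp_add, exp_add]
        ring
    _ ≤ _ := by gcongr; norm_num

lemma integrand_le_of_nonpos_of_nonneg {x y z : ℝ} (hx : x ≤ 0) (hy : 0 ≤ y)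
    (hz : z ^ 2 ≤ max (x ^ 2) (y ^ 2)) :
    stdNormalCDF x ^ 2 * (1 - stdNormalCDF y) ^ 2 / (stdNormalPDF x * stdNormalPDF y) ≤
      exp 3 * ((1 + z ^ 2)⁻¹ * exp (-|x - y| / 2)) := by
  have hpx := stdNormalPDF_pos x
  have hpy := stdNormalPDF_pos y
  have h0 : 0 ≤ 1 - stdNormalCDF y := sub_nonneg.2 (stdNormalCDF_le_one y)
  have hx' : 0 ≤ -x := neg_nonneg.2 hx
  have hcx : stdNormalCDF x ≤ exp (1 / 2) * stdNormalPDF x / (1 + -x) := by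
    simpa [stdNormalCDF_neg, stdNormalPDF_neg] using one_sub_stdNormalCDF_le hx'
  have hK : (√(2 * π))⁻¹ ≤ 1 :=
    inv_le_one_of_one_le₀ (one_le_sqrt.2 (by linarith [pi_gt_three]))
  have hprod : stdNormalPDF x * stdNormalPDF y ≤ exp (1 / 2) * exp (-|x - y| / 2) := by
    calc _ ≤ (1 * exp (-x ^ 2 / 2)) * (1 * exp (-y ^ 2 / 2)) := by
          unfold stdNormalPDF
          gcongr
      _ ≤ _ := by
          rw [one_mul, one_mul, ← exp_add, ← exp_add, exp_le_exp, abs_of_nonpos (by linarith)]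
          nlinarith [sq_nonneg (x + 1 / 2), sq_nonneg (y - 1 / 2)]
  have hzz : 1 + z ^ 2 ≤ ((1 + -x) * (1 + y)) ^ 2 := by
    have h1 : 1 + -x ≤ (1 + -x) * (1 + y) := by nlinarith
    have h2 : 1 + y ≤ (1 + -x) * (1 + y) := by nlinarith
    rcases le_max_iff.1 hz with h | h <;> nlinarith
  calc _ ≤ (exp (1 / 2) * stdNormalPDF x / (1 + -x)) ^ 2 *
          (exp (1 / 2) * stdNormalPDF y / (1 + y)) ^ 2 / (stdNormalPDF x * stdNormalPDF y) := by
        gcongr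
        · exact stdNormalCDF_nonneg x
        · exact one_sub_stdNormalCDF_le hy
    _ = exp (1 / 2) ^ 4 *
          ((((1 + -x) * (1 + y)) ^ 2)⁻¹ * (stdNormalPDF x * stdNormalPDF y)) := by
        have : 1 + -x ≠ 0 := by positivity
        field_simp
    _ ≤ exp (1 / 2) ^ 4 * ((1 + z ^ 2)⁻¹ * (exp (1 / 2) * exp (-|x - y| / 2))) := by
        gcongr
    _ = exp (5 / 2) * ((1 + z ^ 2)⁻¹ * exp (-|x - y| / 2)) := by
        rw [show (5 / 2 : ℝ) = 1 / 2 + 1 / 2 + 1 / 2 + 1 / 2 + 1 / 2 by norm_num]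
        simp only [exp_add]
        ring
    _ ≤ _ := by gcongr; norm_num

lemma integrand_le {x y z : ℝ} (hxy : x ≤ y) (hz : z ^ 2 ≤ max (x ^ 2) (y ^ 2)) :
    stdNormalCDF x ^ 2 * (1 - stdNormalCDF y) ^ 2 / (stdNormalPDF x * stdNormalPDF y) ≤
      exp 3 * ((1 + z ^ 2)⁻¹ * exp (-|x - y| / 2)) := by
  rcases le_total 0 x with hx | hx
  · exact integrand_le_of_nonneg hx hxy (hz.trans (max_le (by gcongr) le_rfl))
  rcases le_total 0 y with hy | hy
  · exact integrand_le_of_nonpos_of_nonneg hx hy hz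
  have h := integrand_le_of_nonneg (x := -y) (y := -x) (z := z) (by linarith) (by linarith)
    (hz.trans (max_le (by simp) (by nlinarith)))
  rw [stdNormalCDF_neg, stdNormalCDF_neg, stdNormalPDF_neg, stdNormalPDF_neg, sub_sub_cancel,
    show -y - -x = x - y by ring] at h
  rwa [mul_comm (stdNormalCDF x ^ 2), mul_comm (stdNormalPDF x)]

lemma integrable_exp_neg_abs_div_two : Integrable fun t : ℝ => exp (-|t| / 2) := by
  have hIoi : IntegrableOn (fun t : ℝ => exp (-|t| / 2)) (Set.Ioi 0) :=
    (integrableOn_exp_mul_Ioi (a := -1 / 2) (by norm_num) 0).congr_fun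
      (fun t ht => by simp only [abs_of_pos (Set.mem_Ioi.1 ht)]; ring_nf) measurableSet_Ioi
  have hIic : IntegrableOn (fun t : ℝ => exp (-|t| / 2)) (Set.Iic 0) :=
    (integrableOn_exp_mul_Iic (a := 1 / 2) (by norm_num) 0).congr_fun
      (fun t ht => by simp only [abs_of_nonpos (Set.mem_Iic.1 ht)]; ring_nf) measurableSet_Iic
  rw [← integrableOn_univ, ← Set.Iic_union_Ioi (a := (0 : ℝ))]
  exact hIic.union hIoi

theorem stmt_3 :
    ∫⁻ p : ℝ × ℝ, ENNReal.ofReal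
        (stdNormalCDF (min p.1 p.2) ^ 2 * (1 - stdNormalCDF (max p.1 p.2)) ^ 2
          / (stdNormalPDF p.1 * stdNormalPDF p.2)) < ⊤ := by
  have hint : Integrable fun p : ℝ × ℝ =>
      exp 3 * ((1 + p.2 ^ 2)⁻¹ * exp (-|p.1 - p.2| / 2)) :=
    (integrable_inv_one_add_sq.convolution_integrand (ContinuousLinearMap.mul ℝ ℝ)
      integrable_exp_neg_abs_div_two).const_mul (exp 3)
  refine (lintegral_mono fun p => ENNReal.ofReal_le_ofReal ?_).trans_lt hint.lintegral_lt_top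
  rcases le_total p.1 p.2 with h | h
  · rw [min_eq_left h, max_eq_right h]
    exact integrand_le h (le_max_right _ _)
  · rw [min_eq_right h, max_eq_left h, mul_comm (stdNormalPDF p.1), abs_sub_comm]
    exact integrand_le h (le_max_left _ _)
end

section
/- The function x ↦ 1/x − Φ(x)·(1 − Φ(x))/φ(x) is absolutely integrable on the interval [1, ∞); in particular the improper integral ∫_{1}^{A} (1/x − Φ(x)(1 − Φ(x))/φ(x)) dx converges to a finite limit as A → ∞. -/
open Real MeasureTheory Filter

lemma continuous_stdNormalPDF : Continuous stdNormalPDF := by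
  unfold stdNormalPDF
  fun_prop

lemma stdNormalPDF_le_one (x : ℝ) : stdNormalPDF x ≤ 1 := by
  unfold stdNormalPDF
  refine mul_le_one₀ (inv_le_one_of_one_le₀ ?_) (exp_pos _).le (exp_le_one_iff.2 ?_)
  · rw [Real.one_le_sqrt]
    linarith [Real.pi_gt_three]
  · nlinarith [sq_nonneg x]

lemma hasDerivAt_stdNormalPDF (x : ℝ) :
    HasDerivAt stdNormalPDF (-x * stdNormalPDF x) x := by
  have h : HasDerivAt (fun y : ℝ => -y ^ 2 / 2) (-x) x := by
    convert! ((hasDerivAt_pow 2 x).neg.div_const 2) using 1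
    simp
    ring
  unfold stdNormalPDF
  convert! h.exp.const_mul (Real.sqrt (2 * Real.pi))⁻¹ using 1
  ring

lemma hasDerivAt_stdNormalCDF (x : ℝ) : HasDerivAt stdNormalCDF (stdNormalPDF x) x := by
  have h : stdNormalCDF = fun y => stdNormalCDF 0 + ∫ t in (0 : ℝ)..y, stdNormalPDF t := by
    ext y
    have := intervalIntegral.integral_Iic_sub_Iic (a := 0) (b := y)
      integrable_stdNormalPDF.integrableOn integrable_stdNormalPDF.integrableOn
    simp only [stdNormalCDF]
    linarith
  rw [h]
  exact (continuous_stdNormalPDF.integral_hasStrictDerivAt 0 x).hasDerivAt.const_add _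

lemma continuous_stdNormalCDF : Continuous stdNormalCDF :=
  continuous_iff_continuousAt.2 fun x => (hasDerivAt_stdNormalCDF x).continuousAt

lemma tendsto_stdNormalCDF_atTop : Tendsto stdNormalCDF atTop (nhds 1) := by
  rw [← integral_stdNormalPDF]
  exact (aecover_Iic tendsto_id).integral_tendsto_of_countably_generated integrable_stdNormalPDF

lemma tendsto_stdNormalPDF_mul_atTop {g : ℝ → ℝ} (hg : Tendsto g atTop (nhds 0)) :
    Tendsto (fun x => stdNormalPDF x * g x) atTop (nhds 0) :=
  bdd_le_mul_tendsto_zero' 1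
    (Eventually.of_forall fun x => by
      rw [abs_of_pos (stdNormalPDF_pos x)]
      exact stdNormalPDF_le_one x) hg

/-- If `g` tends to zero at infinity, the derivative of `1 - Φ - φ g` is
`φ (x g - g' - 1)`, and its sign decides how `1 - Φ` compares with `φ g`. -/
lemma hasDerivAt_one_sub_stdNormalCDF_sub_mul {g : ℝ → ℝ} {g' x : ℝ} (hg : HasDerivAt g g' x) :
    HasDerivAt (fun y => 1 - stdNormalCDF y - stdNormalPDF y * g y)
      (stdNormalPDF x * (x * g x - g' - 1)) x := by
  convert! ((hasDerivAt_stdNormalCDF x).const_sub 1).sub ((hasDerivAt_stdNormalPDF x).mul hg)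
    using 1
  ring

lemma tendsto_one_sub_stdNormalCDF_sub_mul {g : ℝ → ℝ} (hg : Tendsto g atTop (nhds 0)) :
    Tendsto (fun y => 1 - stdNormalCDF y - stdNormalPDF y * g y) atTop (nhds 0) := by
  simpa using (tendsto_stdNormalCDF_atTop.const_sub 1).sub (tendsto_stdNormalPDF_mul_atTop hg)

lemma one_sub_stdNormalCDF_le_s14 {g g' : ℝ → ℝ} {a : ℝ} (hg : Tendsto g atTop (nhds 0))
    (hd : ∀ x ∈ Set.Ici a, HasDerivAt g (g' x) x)
    (h : ∀ x ∈ Set.Ici a, 1 ≤ x * g x - g' x) {x : ℝ} (hx : a ≤ x) :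
    1 - stdNormalCDF x ≤ stdNormalPDF x * g x := by
  have hD := fun y hy => hasDerivAt_one_sub_stdNormalCDF_sub_mul (hd y hy)
  have hm : MonotoneOn (fun y => 1 - stdNormalCDF y - stdNormalPDF y * g y) (Set.Ici a) := by
    refine monotoneOn_of_hasDerivWithinAt_nonneg (convex_Ici a)
      (fun y hy => (hD y hy).continuousAt.continuousWithinAt)
      (fun y hy => (hD y (interior_subset hy)).hasDerivWithinAt) fun y hy => ?_
    exact mul_nonneg (stdNormalPDF_pos y).le (by linarith [h y (interior_subset hy)])
  have := ge_of_tendsto (tendsto_one_sub_stdNormalCDF_sub_mul hg)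
    ((eventually_ge_atTop x).mono fun y hy => hm hx (hx.trans hy) hy)
  simp only at this
  linarith

lemma le_one_sub_stdNormalCDF {g g' : ℝ → ℝ} {a : ℝ} (hg : Tendsto g atTop (nhds 0))
    (hd : ∀ x ∈ Set.Ici a, HasDerivAt g (g' x) x)
    (h : ∀ x ∈ Set.Ici a, x * g x - g' x ≤ 1) {x : ℝ} (hx : a ≤ x) :
    stdNormalPDF x * g x ≤ 1 - stdNormalCDF x := by
  have hD := fun y hy => hasDerivAt_one_sub_stdNormalCDF_sub_mul (hd y hy)
  have hm : AntitoneOn (fun y => 1 - stdNormalCDF y - stdNormalPDF y * g y) (Set.Ici a) := by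
    refine antitoneOn_of_hasDerivWithinAt_nonpos (convex_Ici a)
      (fun y hy => (hD y hy).continuousAt.continuousWithinAt)
      (fun y hy => (hD y (interior_subset hy)).hasDerivWithinAt) fun y hy => ?_
    exact mul_nonpos_of_nonneg_of_nonpos (stdNormalPDF_pos y).le
      (by linarith [h y (interior_subset hy)])
  have := le_of_tendsto (tendsto_one_sub_stdNormalCDF_sub_mul hg)
    ((eventually_ge_atTop x).mono fun y hy => hm hx (hx.trans hy) hy)
  simp only at this
  linarith

lemma one_sub_stdNormalCDF_le_mul_inv {x : ℝ} (hx : 1 ≤ x) :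
    1 - stdNormalCDF x ≤ stdNormalPDF x * x⁻¹ := by
  refine one_sub_stdNormalCDF_le_s14 tendsto_inv_atTop_zero (g' := fun y => -(y ^ 2)⁻¹)
    (fun y (hy : 1 ≤ y) => hasDerivAt_inv (by positivity)) (fun y (hy : 1 ≤ y) => ?_) hx
  have : 0 < y := by linarith
  have h2 : 0 < (y ^ 2)⁻¹ := by positivity
  rw [mul_inv_cancel₀ this.ne']
  linarith

lemma mul_inv_sub_inv_pow_le_one_sub_stdNormalCDF {x : ℝ} (hx : 1 ≤ x) :
    stdNormalPDF x * (x⁻¹ - x⁻¹ ^ 3) ≤ 1 - stdNormalCDF x := by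
  refine le_one_sub_stdNormalCDF (g := fun y : ℝ => y⁻¹ - y⁻¹ ^ 3) ?_
    (fun y (hy : 1 ≤ y) => (hasDerivAt_inv (by positivity)).sub
      ((hasDerivAt_inv (by positivity)).pow 3)) (fun y (hy : 1 ≤ y) => ?_) hx
  · simpa using tendsto_inv_atTop_zero.sub ((tendsto_inv_atTop_zero (𝕜 := ℝ)).pow 3)
  · have hy0 : 0 < y := by linarith
    have h4 : 0 < (y ^ 4)⁻¹ := by positivity
    have : y * (y⁻¹ - y⁻¹ ^ 3) - (-(y ^ 2)⁻¹ - ((3 : ℕ) : ℝ) * y⁻¹ ^ (3 - 1) * -(y ^ 2)⁻¹)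
        = 1 - 3 * (y ^ 4)⁻¹ := by
      push_cast
      field_simp
      ring
    linarith

lemma abs_inv_sub_stdNormalCDF_le {x : ℝ} (hx : 1 ≤ x) :
    |1 / x - stdNormalCDF x * (1 - stdNormalCDF x) / stdNormalPDF x| ≤ 2 * x ^ (-2 : ℝ) := by
  have hx0 : 0 < x := by linarith
  have hφ := stdNormalPDF_pos x
  have hφ1 := stdNormalPDF_le_one x
  have hup := one_sub_stdNormalCDF_le_mul_inv hx
  have hlow := mul_inv_sub_inv_pow_le_one_sub_stdNormalCDF hx
  have hQ : 0 ≤ 1 - stdNormalCDF x := sub_nonneg.2 (stdNormalCDF_le_one x)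
  rw [show x ^ (-2 : ℝ) = x⁻¹ ^ 2 by rw [rpow_neg hx0.le, inv_pow]; norm_cast, one_div]
  have hu0 : 0 < x⁻¹ := inv_pos.2 hx0
  have hu1 : x⁻¹ ≤ 1 := inv_le_one_of_one_le₀ hx
  generalize x⁻¹ = u at *
  obtain ⟨r, hr⟩ : ∃ r, 1 - stdNormalCDF x = stdNormalPDF x * r :=
    ⟨(1 - stdNormalCDF x) / stdNormalPDF x, by field_simp⟩
  have hΦ : stdNormalCDF x = 1 - stdNormalPDF x * r := by linarith
  rw [hr] at hup hlow hQ
  rw [hr, hΦ]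
  generalize stdNormalPDF x = p at *
  have h1 : r ≤ u := le_of_mul_le_mul_left hup hφ
  have h2 : u - u ^ 3 ≤ r := le_of_mul_le_mul_left hlow hφ
  have h3 : 0 ≤ r := nonneg_of_mul_nonneg_right hQ hφ
  have hf : u - (1 - p * r) * (p * r) / p = u - r + p * r ^ 2 := by
    field_simp
    ring
  have h4 : 0 ≤ p * r ^ 2 := by positivity
  have h5 : p * r ^ 2 ≤ 1 * u ^ 2 := by gcongr
  have h6 : u ^ 3 ≤ u ^ 2 := pow_le_pow_of_le_one hu0.le hu1 (by norm_num)
  rw [hf, abs_of_nonneg (by linarith)]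
  linarith

theorem stmt_14 :
    IntegrableOn
        (fun x : ℝ => 1 / x - stdNormalCDF x * (1 - stdNormalCDF x) / stdNormalPDF x)
        (Set.Ici 1) ∧
      ∃ L : ℝ, Tendsto
        (fun A : ℝ => ∫ x in (1 : ℝ)..A,
          (1 / x - stdNormalCDF x * (1 - stdNormalCDF x) / stdNormalPDF x))
        atTop (nhds L) := by
  have hmeas : Measurable
      (fun x : ℝ => 1 / x - stdNormalCDF x * (1 - stdNormalCDF x) / stdNormalPDF x) := by
    have h1 := continuous_stdNormalCDF.measurable
    have h2 := continuous_stdNormalPDF.measurable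
    fun_prop
  have hint : IntegrableOn
      (fun x : ℝ => 1 / x - stdNormalCDF x * (1 - stdNormalCDF x) / stdNormalPDF x)
      (Set.Ioi 1) := by
    refine Integrable.mono'
      ((integrableOn_Ioi_rpow_of_lt (a := -2) (by norm_num) one_pos).const_mul 2)
      hmeas.aestronglyMeasurable ?_
    refine (ae_restrict_iff' measurableSet_Ioi).2 (Eventually.of_forall fun x hx => ?_)
    exact abs_inv_sub_stdNormalCDF_le (le_of_lt hx)
  exact ⟨(integrableOn_Ici_iff_integrableOn_Ioi (by simp)).2 hint, _,
    intervalIntegral_tendsto_integral_Ioi 1 hint tendsto_id⟩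
end
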